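/- Let m ≥ 2 be a natural number. There do not exist finite abelian groups A, B, C, D together with group homomorphisms b : B → A, a : A → ℤ/mℤ, c : ℤ/mℤ → C, d : C → D and b' : D → C, a' : C → ℤ/mℤ, c' : ℤ/mℤ → A, d' : A → B such that: b and b' are injective, d and d' are surjective, the pairs (b,a), (a,c), (c,d) and (b',a'), (a',c'), (c',d') are exact, and the maps a : A → ℤ/mℤ and a' : C → ℤ/mℤ are surjective. -/

import Mathlib

theorem stmt_0 (m : ℕ) (hm : 2 ≤ m)
    (A B C D : Type) [AddCommGroup A] [AddCommGroup B] [AddCommGroup C] [AddCommGroup D]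
    [Finite A] [Finite B] [Finite C] [Finite D]
    (b : B →+ A) (a : A →+ ZMod m) (c : ZMod m →+ C) (d : C →+ D)
    (b' : D →+ C) (a' : C →+ ZMod m) (c' : ZMod m →+ A) (d' : A →+ B)
    (hb : Function.Injective ⇑b) (hb' : Function.Injective ⇑b')
    (hd : Function.Surjective ⇑d) (hd' : Function.Surjective ⇑d')
    (hba : Function.Exact ⇑b ⇑a) (hac : Function.Exact ⇑a ⇑c) (hcd : Function.Exact ⇑c ⇑d)
    (hba' : Function.Exact ⇑b' ⇑a') (hac' : Function.Exact ⇑a' ⇑c')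
    (hcd' : Function.Exact ⇑c' ⇑d')
    (ha : Function.Surjective ⇑a) (ha' : Function.Surjective ⇑a') : False := by
  have : Fact (1 < m) := ⟨hm⟩
  have hc'_zero : ∀ x, c' x = 0 := fun x => (hac' x).2 (ha' x)
  have hd'_inj : Function.Injective d' := by
    refine (injective_iff_map_eq_zero d').2 fun x hx => ?_
    obtain ⟨y, rfl⟩ := (hcd' x).1 hx
    exact hc'_zero y
  have hb_surj : Function.Surjective b :=
    (Finite.surjective_of_injective (hb.comp hd'_inj)).of_comp
  obtain ⟨x, hx⟩ := ha 1
  exact one_ne_zero (hx.symm.trans ((hba x).2 (hb_surj x)))
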